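/- Odd (nonlinear) change of variables in the Berezin integral: Let φ₁,…,φₙ ∈ 𝒫_n be odd elements with vanishing 𝔠-component (i.e. φ_j has no summand with a = (0,…,0)), and suppose the n×n matrix ((∂_{θ_k}φ_j)|_{θ=0}), with entries in 𝔠_ev, is invertible over 𝔠_ev. Then the matrix (∂_{θ_k}φ_j) is invertible over the even part of 𝒫_n, and for every v ∈ 𝒫_n: ∫dθ v(θ) = ∫dθ (det(∂_{θ_k}φ_j))^{-1}·v(φ), where v(φ) denotes the substitution θ_j ↦ φ_j. -/

import Mathlib

set_option synthInstance.maxHeartbeats 1000000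
set_option maxHeartbeats 2000000

noncomputable section

/-- The underlying module: countably many generators for `𝔠` plus `n` odd generators `θ`. -/
abbrev GV (n : ℕ) : Type := (ℕ →₀ ℂ) × (Fin n → ℂ)

/-- The big Grassmann algebra `E`, an exterior algebra; `𝒫_n = E`. -/
abbrev GE (n : ℕ) : Type := ExteriorAlgebra ℂ (GV n)

variable (n : ℕ)

/-- The odd generators `θ₁,…,θₙ`. -/
def θg (k : Fin n) : GE n := ExteriorAlgebra.ι ℂ ((0 : ℕ →₀ ℂ), Pi.single k 1)

/-- The subalgebra `𝔠` generated by the countably many generators. -/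
def cAlg : Subalgebra ℂ (GE n) :=
  Algebra.adjoin ℂ (Set.range fun v : ℕ →₀ ℂ => ExteriorAlgebra.ι ℂ (v, (0 : Fin n → ℂ)))

/-- The even part of `E`. -/
def evenPart : Submodule ℂ (GE n) := CliffordAlgebra.evenOdd (0 : QuadraticForm ℂ (GV n)) 0

/-- The odd part of `E`. -/
def oddPart : Submodule ℂ (GE n) := CliffordAlgebra.evenOdd (0 : QuadraticForm ℂ (GV n)) 1

/-- Left odd derivative `∂_{θ_s}`: contraction with the dual functional of `θ_s`. -/
def Dθ (s : Fin n) : GE n →ₗ[ℂ] GE n :=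
  CliffordAlgebra.contractLeft ((LinearMap.proj s).comp (LinearMap.snd ℂ (ℕ →₀ ℂ) (Fin n → ℂ)))

/-- The algebra endomorphism setting all `θ`'s to zero. -/
def evalθ0 : GE n →ₐ[ℂ] GE n :=
  CliffordAlgebra.map ⟨(LinearMap.fst ℂ (ℕ →₀ ℂ) (Fin n → ℂ)).prod 0, fun _ => rfl⟩

/-- The Berezin integral `∫ dθ v = ∂_{θ_n} ⋯ ∂_{θ_1} v |_{θ=0} = v_{1̄}`. -/
def berezin (v : GE n) : GE n :=
  evalθ0 n ((List.finRange n).foldl (fun w s => Dθ n s w) v)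

/-- `θ^a` for a multi-index `a ∈ {0,1}ⁿ`, factors in increasing order. -/
def θpow (a : Fin n → Bool) : GE n :=
  (List.ofFn fun k => if a k then θg n k else 1).prod

/-- `|a|`: the number of `1` entries of the multi-index `a`. -/
def mIdxCard (a : Fin n → Bool) : ℕ := (Finset.univ.filter fun k => a k).card

/-- Determinant of a matrix with entries in `E` (entries are assumed central, e.g. even
elements), as the usual signed sum over permutations of ordered products. -/
def detE (M : Matrix (Fin n) (Fin n) (GE n)) : GE n :=
  ∑ σ : Equiv.Perm (Fin n), (Equiv.Perm.sign σ : ℤ) • (List.ofFn fun i => M (σ i) i).prod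

section Helpers

variable {n}

/-- The grade involution of `E`. -/
abbrev gradeInv : GE n →ₐ[ℂ] GE n :=
  CliffordAlgebra.involute (Q := (0 : QuadraticForm ℂ (GV n)))

/-- The generator of `E` attached to a vector. -/
abbrev gen (v : GV n) : GE n := ExteriorAlgebra.ι ℂ v

theorem GE_induction {P : GE n → Prop} (hs : ∀ r : ℂ, P (algebraMap ℂ (GE n) r))
    (ha : ∀ x y, P x → P y → P (x + y)) (hm : ∀ v x, P x → P (gen v * x)) (x : GE n) : P x :=
  CliffordAlgebra.left_induction (0 : QuadraticForm ℂ (GV n)) hs ha (fun x v => hm v x) x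

theorem gen_mul_swap (v w : GV n) : gen v * gen w = -(gen w * gen v) :=
  eq_neg_of_add_eq_zero_left (ExteriorAlgebra.ι_add_mul_swap v w)

theorem gradeInv_gen (v : GV n) : gradeInv (gen v) = -gen v :=
  CliffordAlgebra.involute_ι v

theorem gradeInv_θg (k : Fin n) : gradeInv (θg n k) = -θg n k :=
  gradeInv_gen _

theorem gradeInv_gradeInv (x : GE n) : gradeInv (gradeInv x) = x :=
  CliffordAlgebra.involute_involute x

theorem gen_mul_eq (v : GV n) (y : GE n) : gen v * y = gradeInv y * gen v := by
  induction y using GE_induction with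
  | hs r => rw [AlgHom.commutes, Algebra.commutes]
  | ha x y hx hy => rw [mul_add, hx, hy, map_add, add_mul]
  | hm w x hx =>
    rw [map_mul, gradeInv_gen, ← mul_assoc, gen_mul_swap, neg_mul, mul_assoc, hx, neg_mul, neg_mul,
      mul_assoc]

theorem commute_of_gradeInv_eq {x : GE n} (hx : gradeInv x = x) (y : GE n) : Commute x y := by
  induction y using GE_induction with
  | hs r => exact (Algebra.commutes r x).symm
  | ha y z hy hz => exact hy.add_right hz
  | hm v y hy => exact Commute.mul_right ((gen_mul_eq v x).trans (by rw [hx])).symm hy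

theorem mem_evenPart_iff {x : GE n} : x ∈ evenPart n ↔ gradeInv x = x := by
  refine ⟨fun h => CliffordAlgebra.involute_eq_of_mem_even h, fun h => ?_⟩
  have htop : x ∈ evenPart n ⊔ oddPart n := by
    have := (CliffordAlgebra.evenOdd_isCompl (0 : QuadraticForm ℂ (GV n))).sup_eq_top
    rw [evenPart, oddPart, this]
    trivial
  obtain ⟨a, ha, b, hb, rfl⟩ := Submodule.mem_sup.1 htop
  have ha' : gradeInv a = a := CliffordAlgebra.involute_eq_of_mem_even ha
  have hb' : gradeInv b = -b := CliffordAlgebra.involute_eq_of_mem_odd hb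
  rw [map_add, ha', hb', add_right_inj] at h
  have : b = 0 := by
    have h2 : (2 : ℂ) • b = 0 := by rw [two_smul, ← eq_neg_iff_add_eq_zero, h]
    exact (smul_eq_zero.1 h2).resolve_left two_ne_zero
  rw [this, add_zero]
  exact ha

theorem gradeInv_of_mem_oddPart {x : GE n} (h : x ∈ oddPart n) : gradeInv x = -x :=
  CliffordAlgebra.involute_eq_of_mem_odd h

theorem Dθ_gen_mul (k : Fin n) (v : GV n) (x : GE n) :
    Dθ n k (gen v * x) = v.2 k • x - gen v * Dθ n k x :=
  CliffordAlgebra.contractLeft_ι_mul (Q := (0 : QuadraticForm ℂ (GV n))) _ _ _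

theorem Dθ_algebraMap (k : Fin n) (r : ℂ) : Dθ n k (algebraMap ℂ (GE n) r) = 0 :=
  CliffordAlgebra.contractLeft_algebraMap (0 : QuadraticForm ℂ (GV n)) _ _

theorem Dθ_gen (k : Fin n) (v : GV n) : Dθ n k (gen v) = algebraMap ℂ (GE n) (v.2 k) :=
  CliffordAlgebra.contractLeft_ι (0 : QuadraticForm ℂ (GV n)) _ _

theorem Dθ_Dθ_self (k : Fin n) (x : GE n) : Dθ n k (Dθ n k x) = 0 :=
  CliffordAlgebra.contractLeft_contractLeft _ _

theorem Dθ_comm (j k : Fin n) (x : GE n) : Dθ n j (Dθ n k x) = -Dθ n k (Dθ n j x) :=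
  CliffordAlgebra.contractLeft_comm _ _ _

theorem Dθ_mul (k : Fin n) (x y : GE n) :
    Dθ n k (x * y) = Dθ n k x * y + gradeInv x * Dθ n k y := by
  induction x using GE_induction with
  | hs r => simp [← Algebra.smul_def, Dθ_algebraMap]
  | ha a b hx hy => simp only [add_mul, map_add, hx, hy]; abel
  | hm v x hx =>
    rw [mul_assoc, Dθ_gen_mul, Dθ_gen_mul, hx, map_mul, gradeInv_gen, sub_mul, mul_add,
      smul_mul_assoc, neg_mul, neg_mul, mul_assoc, mul_assoc]
    abel

theorem gradeInv_Dθ (k : Fin n) (x : GE n) : gradeInv (Dθ n k x) = -Dθ n k (gradeInv x) := by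
  induction x using GE_induction with
  | hs r => simp [Dθ_algebraMap]
  | ha a b hx hy => simp only [map_add, hx, hy]; abel
  | hm v x hx =>
    rw [Dθ_gen_mul, map_sub, map_smul, map_mul, map_mul, gradeInv_gen, hx, neg_mul, neg_mul,
      map_neg, Dθ_gen_mul]
    simp

theorem Dθ_θg_mul (j k : Fin n) (x : GE n) :
    Dθ n j (θg n k * x) = (if j = k then x else 0) - θg n k * Dθ n j x := by
  rw [θg, Dθ_gen_mul]
  simp [Pi.single_apply]

theorem θg_mul_self (k : Fin n) : θg n k * θg n k = 0 :=
  ExteriorAlgebra.ι_sq_zero _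

theorem θg_mul_eq (k : Fin n) (y : GE n) : θg n k * y = gradeInv y * θg n k :=
  gen_mul_eq _ _

theorem evalθ0_gen (v : GV n) : evalθ0 n (gen v) = gen (v.1, 0) :=
  CliffordAlgebra.map_apply_ι _ _

theorem evalθ0_θg (k : Fin n) : evalθ0 n (θg n k) = 0 := by
  rw [θg, evalθ0_gen]
  exact map_zero (ExteriorAlgebra.ι ℂ)

theorem gradeInv_evalθ0 (x : GE n) : gradeInv (evalθ0 n x) = evalθ0 n (gradeInv x) := by
  induction x using GE_induction with
  | hs r => simp
  | ha a b hx hy => simp only [map_add, hx, hy]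
  | hm v x hx => rw [map_mul, map_mul, map_mul, map_mul, hx, evalθ0_gen, gradeInv_gen, gradeInv_gen,
      map_neg, evalθ0_gen]

theorem Dθ_evalθ0 (k : Fin n) (x : GE n) : Dθ n k (evalθ0 n x) = 0 := by
  induction x using GE_induction with
  | hs r => simp [Dθ_algebraMap]
  | ha a b hx hy => simp only [map_add, hx, hy, add_zero]
  | hm v x hx => rw [map_mul, evalθ0_gen, Dθ_gen_mul, hx]; simp

theorem evalθ0_evalθ0 (x : GE n) : evalθ0 n (evalθ0 n x) = evalθ0 n x := by
  induction x using GE_induction with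
  | hs r => simp
  | ha a b hx hy => simp only [map_add, hx, hy]
  | hm v x hx => rw [map_mul, map_mul, evalθ0_gen, evalθ0_gen, hx]

theorem gen_eq (v : GV n) : gen v = gen (v.1, 0) + ∑ k, v.2 k • θg n k := by
  simp only [θg, gen, ← map_smul, ← map_sum, ← map_add]
  congr 1
  ext i
  · simp [Prod.fst_sum]
  · simp [Prod.snd_sum, Finset.sum_apply, Pi.single_apply]

theorem exists_eq_evalθ0_add (x : GE n) :
    ∃ m : Fin n → GE n, x = evalθ0 n x + ∑ k, θg n k * m k := by
  induction x using GE_induction with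
  | hs r => exact ⟨0, by simp⟩
  | ha x y hx hy =>
    obtain ⟨a, ha⟩ := hx
    obtain ⟨b, hb⟩ := hy
    refine ⟨a + b, ?_⟩
    simp only [Pi.add_apply, mul_add, Finset.sum_add_distrib, map_add]
    nth_rw 1 [ha, hb]
    abel
  | hm v x hx =>
    obtain ⟨a, ha⟩ := hx
    refine ⟨fun k => v.2 k • evalθ0 n x - gen v * a k, ?_⟩
    have hθ (k : Fin n) : gen v * θg n k = -(θg n k * gen v) := gen_mul_swap _ _
    nth_rw 1 [ha]
    rw [mul_add, map_mul, evalθ0_gen]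
    nth_rw 1 [gen_eq v]
    simp only [add_mul, Finset.sum_mul, Finset.mul_sum, mul_sub, Finset.sum_sub_distrib,
      ← mul_assoc, hθ, neg_mul, smul_mul_assoc, mul_smul_comm, Finset.sum_neg_distrib]
    abel

theorem exists_eq_sum_θg_mul {x : GE n} (h0 : evalθ0 n x = 0) {ε : ℂ} (hε : ε * ε = 1)
    (hx : gradeInv x = ε • x) :
    ∃ m : Fin n → GE n, (∀ k, gradeInv (m k) = -(ε • m k)) ∧ x = ∑ k, θg n k * m k := by
  obtain ⟨a, ha⟩ := exists_eq_evalθ0_add x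
  rw [h0, zero_add] at ha
  refine ⟨fun k => (2⁻¹ : ℂ) • (a k - ε • gradeInv (a k)), fun k => ?_, ?_⟩
  · simp only [map_smul, map_sub, gradeInv_gradeInv, smul_sub, smul_smul]
    rw [show ε * (2⁻¹ * ε) = 2⁻¹ by rw [mul_left_comm, hε, mul_one], mul_comm ε]
    abel
  · have h2 : ∑ k, θg n k * (ε • gradeInv (a k)) = -x := by
      have h3 : x = ε • gradeInv x := by rw [hx, smul_smul, hε, one_smul]
      conv_rhs => rw [h3, ha]
      simp [map_sum, map_mul, gradeInv_θg, Finset.smul_sum]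
    simp only [mul_smul_comm (2⁻¹ : ℂ), ← Finset.smul_sum, mul_sub, Finset.sum_sub_distrib]
    rw [h2, ← ha, sub_neg_eq_add, ← two_smul ℂ x, smul_smul]
    norm_num

/-- The even part of `E` as a subalgebra. -/
def evAlg (n : ℕ) : Subalgebra ℂ (GE n) := AlgHom.equalizer gradeInv (AlgHom.id ℂ (GE n))

theorem mem_evAlg {x : GE n} : x ∈ evAlg n ↔ gradeInv x = x := Iff.rfl

instance : CommRing (evAlg n) :=
  { (inferInstance : Ring (evAlg n)) with
    mul_comm := fun x y => Subtype.ext (commute_of_gradeInv_eq x.2 y.1) }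

instance : Algebra (evAlg n) (GE n) :=
  Algebra.ofModule' (fun r x => by simp [Subalgebra.smul_def])
    (fun r x => by
      rw [Subalgebra.smul_def, Subalgebra.smul_def, smul_eq_mul, smul_eq_mul, mul_one]
      exact (commute_of_gradeInv_eq r.2 x).symm)

theorem coe_detE_matrix (M : Matrix (Fin n) (Fin n) (evAlg n)) :
    detE n (M.map (↑)) = (M.det : GE n) := by
  rw [Matrix.det_apply, detE, AddSubmonoidClass.coe_finsetSum]
  refine Finset.sum_congr rfl fun σ _ => ?_
  rw [← List.prod_ofFn, Units.smul_def, ← (evAlg n).val_apply, map_zsmul, map_list_prod,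
    List.map_ofFn]
  rfl

theorem evalθ0_mem_evAlg (x : evAlg n) : evalθ0 n x ∈ evAlg n := by
  rw [mem_evAlg, gradeInv_evalθ0, mem_evAlg.1 x.2]

/-- Evaluation at `θ = 0` on even elements. -/
def evEval0 : evAlg n →ₐ[ℂ] evAlg n :=
  ((evalθ0 n).comp (evAlg n).val).codRestrict (evAlg n) evalθ0_mem_evAlg

theorem isNilpotent_of_evalθ0_eq_zero (x : evAlg n) (hx : evalθ0 n x = 0) : IsNilpotent x := by
  obtain ⟨m, hm, hxm⟩ := exists_eq_sum_θg_mul hx (ε := 1) (by simp)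
    (by rw [mem_evAlg.1 x.2, one_smul])
  have hmem (k : Fin n) : θg n k * m k ∈ evAlg n := by
    rw [mem_evAlg, map_mul, gradeInv_θg, hm, one_smul, neg_mul_neg]
  have hx' : x = ∑ k, (⟨θg n k * m k, hmem k⟩ : evAlg n) := by
    ext
    rw [hxm, AddSubmonoidClass.coe_finsetSum]
  rw [hx']
  refine isNilpotent_sum fun k _ => ⟨2, Subtype.ext ?_⟩
  have : θg n k * m k * (θg n k * m k) = 0 := by
    rw [mul_assoc, ← mul_assoc (m k), ← gradeInv_gradeInv (m k), ← θg_mul_eq, ← mul_assoc,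
      ← mul_assoc, θg_mul_self, zero_mul, zero_mul]
  rw [sq]
  exact this

theorem isUnit_of_isUnit_evEval0 {x : evAlg n} (h : IsUnit (evEval0 x)) : IsUnit x := by
  have h2 : IsNilpotent (x - evEval0 x) := isNilpotent_of_evalθ0_eq_zero _ (by
    change evalθ0 n (x.1 - evalθ0 n x.1) = 0
    rw [map_sub, evalθ0_evalθ0, sub_self])
  simpa using h2.isUnit_add_left_of_commute h (Commute.all _ _)

/-- `∂_{θ_k}` as a derivation on even elements. -/
def evDer (k : Fin n) : Derivation ℂ (evAlg n) (GE n) :=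
  Derivation.mk' ((Dθ n k).comp (evAlg n).val.toLinearMap) fun a b => by
    change Dθ n k (a.1 * b.1) = a.1 * Dθ n k b.1 + b.1 * Dθ n k a.1
    rw [Dθ_mul, mem_evAlg.1 a.2, (commute_of_gradeInv_eq b.2 (Dθ n k a.1)).eq, add_comm]

theorem derivation_prod {R A N ι : Type*} [CommRing R] [CommRing A] [Algebra R A] [AddCommGroup N]
    [Module R N] [Module A N] [DecidableEq ι] (D : Derivation R A N) (s : Finset ι) (f : ι → A) :
    D (∏ i ∈ s, f i) = ∑ i ∈ s, (∏ j ∈ s.erase i, f j) • D (f i) := by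
  induction s using Finset.induction_on with
  | empty => simp
  | insert a s ha ih =>
    rw [Finset.prod_insert ha, Derivation.leibniz, ih, Finset.sum_insert ha,
      Finset.erase_insert ha, Finset.smul_sum, add_comm]
    congr 1
    refine Finset.sum_congr rfl fun i hi => ?_
    have hia : a ≠ i := fun h => ha (h ▸ hi)
    rw [Finset.erase_insert_of_ne hia, Finset.prod_insert (fun h => ha (Finset.mem_of_mem_erase h)),
      smul_smul]

theorem adjugate_apply_eq_sum {A ι : Type*} [CommRing A] [Fintype ι] [DecidableEq ι]
    (X : Matrix ι ι A) (i k : ι) :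
    X.adjugate i k = ∑ σ : Equiv.Perm ι, Equiv.Perm.sign σ •
      if σ i = k then ∏ j ∈ Finset.univ.erase i, X (σ j) j else 0 := by
  rw [← Matrix.transpose_apply X.adjugate, Matrix.adjugate_transpose, Matrix.adjugate_apply,
    Matrix.updateRow_transpose, Matrix.det_transpose, Matrix.det_apply]
  refine Finset.sum_congr rfl fun σ _ => ?_
  congr 1
  rw [← Finset.mul_prod_erase _ _ (Finset.mem_univ i), Matrix.updateCol_self, Pi.single_apply,
    ite_mul, one_mul, zero_mul]
  refine if_congr Iff.rfl (Finset.prod_congr rfl fun j hj => ?_) rfl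
  rw [Matrix.updateCol_ne (Finset.ne_of_mem_erase hj)]

/-- Jacobi's formula for the derivative of a determinant along a derivation. -/
theorem derivation_det {R A N ι : Type*} [CommRing R] [CommRing A] [Algebra R A] [AddCommGroup N]
    [Module R N] [Module A N] [Fintype ι] [DecidableEq ι] (D : Derivation R A N)
    (X : Matrix ι ι A) :
    D X.det = ∑ i, ∑ k, X.adjugate i k • D (X k i) := by
  simp_rw [Matrix.det_apply, adjugate_apply_eq_sum, Units.smul_def, map_sum, map_zsmul,
    derivation_prod, Finset.sum_smul, Finset.smul_sum]
  rw [Finset.sum_comm]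
  refine Finset.sum_congr rfl fun i _ => ?_
  rw [Finset.sum_comm]
  refine Finset.sum_congr rfl fun σ _ => ?_
  rw [Finset.sum_eq_single (σ i)]
  · rw [if_pos rfl, smul_assoc]
  · intro k _ hk
    rw [if_neg hk.symm, smul_zero, zero_smul]
  · simp

/-- The derivative of an inverse matrix along a derivation. -/
theorem derivation_inverse {R A N ι : Type*} [CommRing R] [CommRing A] [Algebra R A]
    [AddCommGroup N] [Module R N] [Module A N] [Fintype ι] [DecidableEq ι] (D : Derivation R A N)
    {M C : Matrix ι ι A} (h : M * C = 1) (s r : ι) :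
    D (C s r) = -∑ p, ∑ q, (C s p * C q r) • D (M p q) := by
  have h' : C * M = 1 := mul_eq_one_comm.1 h
  have key (p : ι) : ∑ q, M p q • D (C q r) = -∑ q, C q r • D (M p q) := by
    rw [eq_neg_iff_add_eq_zero, ← Finset.sum_add_distrib]
    have : D ((M * C) p r) = 0 := by
      rw [h, Matrix.one_apply]
      split_ifs <;> simp
    simpa [Matrix.mul_apply] using this
  calc D (C s r) = ∑ q, (C * M) s q • D (C q r) := by simp [h', Matrix.one_apply, ite_smul]
    _ = ∑ p, C s p • ∑ q, M p q • D (C q r) := by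
      simp_rw [Matrix.mul_apply, Finset.sum_smul, Finset.smul_sum, smul_smul]
      exact Finset.sum_comm
    _ = _ := by simp_rw [key, smul_neg, Finset.smul_sum, smul_smul, Finset.sum_neg_distrib]

/-- The Piola identity: the columns of the inverse Jacobian matrix, weighted by the inverse
determinant, are divergence free. -/
theorem sum_evDer_inverse_eq_zero {φ : Fin n → GE n} {M C : Matrix (Fin n) (Fin n) (evAlg n)}
    (hM : ∀ j k, (M j k : GE n) = Dθ n k (φ j)) (hMC : M * C = 1) {d : evAlg n}
    (hd : M.det * d = 1) (k : Fin n) :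
    ∑ j, evDer j (d * C j k) = 0 := by
  have hadj (i l : Fin n) : d * M.adjugate i l = C i l := by
    have : M.adjugate = M.det • C := by
      rw [← mul_one M.adjugate, ← hMC, ← mul_assoc, Matrix.adjugate_mul, smul_mul_assoc, one_mul]
    rw [this, Matrix.smul_apply, smul_eq_mul, ← mul_assoc, mul_comm d, hd, one_mul]
  have hH (j q p : Fin n) : evDer j (M p q) = -evDer q (M p j) := by
    change Dθ n j (M p q : GE n) = -Dθ n q (M p j : GE n)
    rw [hM, hM, Dθ_comm]
  have hDd (j : Fin n) : evDer j d = -∑ q, ∑ p, (d * C q p) • evDer j (M p q) := by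
    have h1 : M.det • evDer j d = -(d • evDer j M.det) := by
      rw [eq_neg_iff_add_eq_zero, ← Derivation.leibniz, hd, Derivation.map_one_eq_zero]
    calc evDer j d = d • M.det • evDer j d := by rw [smul_smul, mul_comm d, hd, one_smul]
      _ = _ := by
        rw [h1, derivation_det]
        simp_rw [smul_neg, Finset.smul_sum, smul_smul, ← hadj]
  simp_rw [Derivation.leibniz, hDd, derivation_inverse _ hMC, smul_neg, Finset.smul_sum,
    smul_smul, Finset.sum_add_distrib, Finset.sum_neg_distrib]
  rw [add_eq_zero_iff_eq_neg, neg_neg]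
  have h2 : ∑ j, ∑ p, ∑ q, (d * (C j p * C q k)) • evDer j (M p q) =
      ∑ q, ∑ j, ∑ p, (d * (C j p * C q k)) • evDer j (M p q) :=
    (Finset.sum_congr rfl fun _ _ => Finset.sum_comm).trans Finset.sum_comm
  rw [h2, ← Finset.sum_neg_distrib]
  refine Finset.sum_congr rfl fun q _ => ?_
  simp_rw [← Finset.sum_neg_distrib]
  refine Finset.sum_congr rfl fun j _ => Finset.sum_congr rfl fun p _ => ?_
  rw [hH j q p, smul_neg, neg_neg]
  congr 1
  ring

/-- Chain rule. -/
theorem Dθ_algHom {φ : Fin n → GE n} (hφ : ∀ j, gradeInv (φ j) = -φ j) (S : GE n →ₐ[ℂ] GE n)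
    (hS : ∀ x : ℕ →₀ ℂ, S (gen (x, 0)) = gen (x, 0)) (hSθ : ∀ j, S (θg n j) = φ j)
    (k : Fin n) (w : GE n) :
    Dθ n k (S w) = ∑ j, Dθ n k (φ j) * S (Dθ n j w) := by
  induction w using GE_induction with
  | hs r => simp [Dθ_algebraMap]
  | ha x y hx hy => simp only [map_add, hx, hy, mul_add, Finset.sum_add_distrib]
  | hm v x hx =>
    have hSv : S (gen v) = gen (v.1, 0) + ∑ j, v.2 j • φ j := by
      rw [gen_eq v, map_add, map_sum, hS]
      simp_rw [map_smul, hSθ]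
    have hodd : gradeInv (S (gen v)) = -S (gen v) := by
      rw [hSv]
      simp [hφ, add_comm]
    have hD : Dθ n k (S (gen v)) = ∑ j, v.2 j • Dθ n k (φ j) := by
      rw [hSv, map_add, Dθ_gen, map_sum]
      simp
    have hcomm (j : Fin n) : S (gen v) * Dθ n k (φ j) = Dθ n k (φ j) * S (gen v) := by
      refine (commute_of_gradeInv_eq ?_ _).symm
      rw [gradeInv_Dθ, hφ, map_neg, neg_neg]
    rw [map_mul, Dθ_mul, hodd, hD, hx]
    simp_rw [Dθ_gen_mul, map_sub, map_smul, map_mul, mul_sub, Finset.sum_sub_distrib,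
      Finset.sum_mul, Finset.mul_sum, neg_mul, ← mul_assoc, hcomm, Finset.sum_neg_distrib,
      smul_mul_assoc, mul_smul_comm, sub_eq_add_neg]

theorem algHom_evalθ0 (S : GE n →ₐ[ℂ] GE n)
    (hS : ∀ x : ℕ →₀ ℂ, S (gen (x, 0)) = gen (x, 0)) (x : GE n) :
    S (evalθ0 n x) = evalθ0 n x := by
  induction x using GE_induction with
  | hs r => simp
  | ha x y hx hy => simp only [map_add, hx, hy]
  | hm v x hx => rw [map_mul, map_mul, hx, evalθ0_gen, hS]

/-- The iterated derivative `∂_{k_m} ⋯ ∂_{k_1}` for a list `[k_1, …, k_m]`. -/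
def iterDθ : List (Fin n) → GE n →ₗ[ℂ] GE n
  | [] => LinearMap.id
  | k :: l => (iterDθ l).comp (Dθ n k)

theorem iterDθ_cons (k : Fin n) (l : List (Fin n)) (v : GE n) :
    iterDθ (k :: l) v = iterDθ l (Dθ n k v) := rfl

theorem foldl_Dθ (l : List (Fin n)) (v : GE n) :
    l.foldl (fun w s => Dθ n s w) v = iterDθ l v := by
  induction l generalizing v with
  | nil => rfl
  | cons k l ih => exact ih _

theorem berezin_eq (v : GE n) : berezin n v = evalθ0 n (iterDθ (List.finRange n) v) := by
  rw [berezin, foldl_Dθ]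

theorem iterDθ_Dθ {l : List (Fin n)} {j : Fin n} (hj : j ∈ l) (w : GE n) :
    iterDθ l (Dθ n j w) = 0 := by
  induction l generalizing w with
  | nil => simp at hj
  | cons k l ih =>
    rw [iterDθ_cons]
    rcases List.mem_cons.1 hj with rfl | h
    · rw [Dθ_Dθ_self, map_zero]
    · rw [Dθ_comm, map_neg, ih h, neg_zero]

theorem berezin_Dθ (j : Fin n) (w : GE n) : berezin n (Dθ n j w) = 0 := by
  rw [berezin_eq, iterDθ_Dθ (List.mem_finRange j), map_zero]

/-- The product of the generators `θ_k` along a list. -/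
def θprod (l : List (Fin n)) : GE n := (l.map (θg n)).prod

theorem θprod_cons (k : Fin n) (l : List (Fin n)) : θprod (k :: l) = θg n k * θprod l :=
  List.prod_cons

theorem Dθ_θprod_mul {l : List (Fin n)} {k : Fin n} (hk : k ∉ l) {y : GE n}
    (hy : Dθ n k y = 0) : Dθ n k (θprod l * y) = 0 := by
  induction l with
  | nil => simpa [θprod] using hy
  | cons j l ih =>
    rw [List.mem_cons, not_or] at hk
    rw [θprod_cons, mul_assoc, Dθ_θg_mul, if_neg hk.1, ih hk.2, mul_zero, sub_zero]

theorem iterDθ_θprod_mul {l : List (Fin n)} (hl : l.Nodup) {y : GE n}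
    (hy : ∀ k, Dθ n k y = 0) : iterDθ l (θprod l * y) = y := by
  induction l with
  | nil => simp [θprod, iterDθ]
  | cons k l ih =>
    rw [List.nodup_cons] at hl
    rw [θprod_cons, mul_assoc, iterDθ_cons, Dθ_θg_mul, if_pos rfl, Dθ_θprod_mul hl.1 (hy k),
      mul_zero, sub_zero, ih hl.2]

theorem θprod_mul_θg {l : List (Fin n)} {k : Fin n} (hk : k ∈ l) : θprod l * θg n k = 0 := by
  induction l with
  | nil => simp at hk
  | cons j l ih =>
    rw [θprod_cons, mul_assoc]
    rcases List.mem_cons.1 hk with rfl | h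
    · rw [← gradeInv_gradeInv (θprod l), ← θg_mul_eq, ← mul_assoc, θg_mul_self, zero_mul]
    · rw [ih h, mul_zero]

theorem θprod_mul_evalθ0 (y : GE n) :
    θprod (List.finRange n) * evalθ0 n y = θprod (List.finRange n) * y := by
  obtain ⟨m, hm⟩ := exists_eq_evalθ0_add y
  conv_rhs => rw [hm]
  rw [mul_add, Finset.mul_sum, Finset.sum_eq_zero, add_zero]
  intro k _
  rw [← mul_assoc, θprod_mul_θg (List.mem_finRange k), zero_mul]

theorem berezin_θprod_mul (y : GE n) :
    berezin n (θprod (List.finRange n) * y) = evalθ0 n y := by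
  rw [berezin_eq, ← θprod_mul_evalθ0, iterDθ_θprod_mul (List.nodup_finRange n)
    (fun k => Dθ_evalθ0 k y), evalθ0_evalθ0]

theorem exists_eq_θprod_mul_iterDθ_add {l : List (Fin n)} (hl : l.Nodup) (v : GE n) :
    ∃ w : Fin n → GE n, (∀ k, k ∉ l → w k = 0) ∧
      v = θprod l * iterDθ l v + ∑ k, Dθ n k (w k) := by
  induction l generalizing v with
  | nil => exact ⟨0, by simp, by simp [θprod, iterDθ]⟩
  | cons k l ih =>
    rw [List.nodup_cons] at hl
    obtain ⟨w, hw, h⟩ := ih hl.2 (Dθ n k v)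
    refine ⟨fun j => -(θg n k * w j) + if j = k then θg n k * v else 0, fun j hj => ?_, ?_⟩
    · rw [List.mem_cons, not_or] at hj
      simp only [hw j hj.2, if_neg hj.1, mul_zero, neg_zero, add_zero]
    · have h1 : v = θg n k * Dθ n k v + Dθ n k (θg n k * v) := by
        rw [Dθ_θg_mul, if_pos rfl, add_sub_cancel]
      have h2 (j : Fin n) : Dθ n j (-(θg n k * w j) + if j = k then θg n k * v else 0) =
          θg n k * Dθ n j (w j) + if j = k then Dθ n k (θg n k * v) else 0 := by
        rw [map_add, map_neg, Dθ_θg_mul]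
        split_ifs with hjk
        · subst hjk
          rw [hw j hl.1]
          simp
        · simp
      simp_rw [h2]
      rw [Finset.sum_add_distrib, Finset.sum_ite_eq' Finset.univ k, if_pos (Finset.mem_univ k),
        ← Finset.mul_sum, θprod_cons, iterDθ_cons, mul_assoc, ← add_assoc, ← mul_add, ← h]
      exact h1

theorem list_prod_sum_smul_θg (X : Matrix (Fin n) (Fin n) (evAlg n)) :
    (List.ofFn fun j => ∑ k, X j k • θg n k).prod = X.det • θprod (List.finRange n) := by
  let f : (Fin n → evAlg n) →ₗ[evAlg n] GE n := Fintype.linearCombination (evAlg n) (θg n)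
  have hf (v : Fin n → evAlg n) : f v * f v = 0 := by
    have hswap : f v * f v = -(f v * f v) := by
      have e : f v = ∑ k, v k • θg n k := Fintype.linearCombination_apply _ _ _
      conv_lhs => rw [e, Finset.sum_mul_sum, Finset.sum_comm]
      rw [e, Finset.sum_mul_sum]
      simp_rw [← Finset.sum_neg_distrib, smul_mul_smul_comm]
      refine Finset.sum_congr rfl fun j _ => Finset.sum_congr rfl fun k _ => ?_
      rw [mul_comm (v k), ← smul_neg]
      congr 1
      exact gen_mul_swap _ _
    have h2 : (2 : ℂ) • (f v * f v) = 0 := by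
      rw [two_smul]
      nth_rw 1 [hswap]
      exact neg_add_cancel _
    exact (smul_eq_zero.1 h2).resolve_left two_ne_zero
  let g : (Fin n → evAlg n) [⋀^Fin n]→ₗ[evAlg n] GE n :=
    (ExteriorAlgebra.lift (evAlg n) ⟨f, hf⟩).toLinearMap.compAlternatingMap
      (ExteriorAlgebra.ιMulti (evAlg n) n)
  have hg (v : Fin n → Fin n → evAlg n) : g v = (List.ofFn fun j => f (v j)).prod := by
    change ExteriorAlgebra.lift (evAlg n) ⟨f, hf⟩ (ExteriorAlgebra.ιMulti (evAlg n) n v) = _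
    rw [ExteriorAlgebra.ιMulti_apply, map_list_prod, List.map_ofFn]
    congr 2
    ext j
    exact ExteriorAlgebra.lift_ι_apply _ _ _ _
  let e := Pi.basisFun (evAlg n) (Fin n)
  have hb : g = (LinearMap.toSpanSingleton (evAlg n) (GE n) (g e)).compAlternatingMap e.det := by
    refine Module.Basis.ext_alternating e fun σ hσ => ?_
    let τ : Equiv.Perm (Fin n) := Equiv.ofBijective σ (Finite.injective_iff_bijective.1 hσ)
    change g (e ∘ τ) = e.det (e ∘ τ) • g e
    rw [AlternatingMap.map_perm, AlternatingMap.map_perm, Module.Basis.det_self, smul_assoc,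
      one_smul]
  have h1 : g e = θprod (List.finRange n) := by
    rw [hg, θprod, List.ofFn_eq_map]
    congr 2
    ext j
    simp [f, e]
  have h2 : g (Matrix.of.symm X) = X.det • g e := by
    conv_lhs => rw [hb]
    change e.det (Matrix.of.symm X) • g e = _
    rw [Pi.basisFun_det_apply]
    rfl
  rw [← h1, ← h2, hg]
  rfl


theorem exists_matrix_of_evalθ0_eq_zero {φ : Fin n → GE n} (hφ : ∀ j, gradeInv (φ j) = -φ j)
    (hφ0 : ∀ j, evalθ0 n (φ j) = 0) :
    ∃ X : Matrix (Fin n) (Fin n) (evAlg n), (∀ j, φ j = ∑ k, X j k • θg n k) ∧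
      ∀ j k, evalθ0 n (X j k) = evalθ0 n (Dθ n k (φ j)) := by
  have h (j : Fin n) := exists_eq_sum_θg_mul (hφ0 j) (ε := -1) (by simp) (by simp [hφ])
  choose m hm hmφ using h
  have hmem (j k : Fin n) : m j k ∈ evAlg n := by
    rw [mem_evAlg, hm, neg_smul, one_smul, neg_neg]
  refine ⟨Matrix.of fun j k => ⟨m j k, hmem j k⟩, fun j => ?_, fun j k => ?_⟩
  · rw [hmφ j]
    exact Finset.sum_congr rfl fun k _ => (commute_of_gradeInv_eq (hmem j k) _).symm
  · rw [hmφ j]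
    simp [Dθ_θg_mul, evalθ0_θg]

theorem berezin_add (v w : GE n) : berezin n (v + w) = berezin n v + berezin n w := by
  simp only [berezin_eq, map_add]

theorem berezin_sum {ι : Type*} (s : Finset ι) (w : ι → GE n) :
    berezin n (∑ j ∈ s, w j) = ∑ j ∈ s, berezin n (w j) := by
  simp only [berezin_eq, map_sum]

theorem berezin_eq_berezin_mul_algHom {φ : Fin n → GE n} (hφ : ∀ j, gradeInv (φ j) = -φ j)
    (hφ0 : ∀ j, evalθ0 n (φ j) = 0) {M C : Matrix (Fin n) (Fin n) (evAlg n)}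
    (hM : ∀ j k, (M j k : GE n) = Dθ n k (φ j)) (hMC : M * C = 1) {d : evAlg n}
    (hd : M.det * d = 1) (S : GE n →ₐ[ℂ] GE n)
    (hS : ∀ x : ℕ →₀ ℂ, S (gen (x, 0)) = gen (x, 0)) (hSθ : ∀ j, S (θg n j) = φ j) (v : GE n) :
    berezin n v = berezin n (d * S v) := by
  have hD (k : Fin n) (w : GE n) : berezin n (d * S (Dθ n k w)) = 0 := by
    have hsum : (d : GE n) * S (Dθ n k w) = ∑ j, Dθ n j ((d * C j k : evAlg n) * S w) := by
      have h0 : ∑ j, Dθ n j (d * C j k : evAlg n) = 0 := sum_evDer_inverse_eq_zero hM hMC hd k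
      simp_rw [Dθ_mul, mem_evAlg.1 (d * C _ k).2]
      rw [Finset.sum_add_distrib, ← Finset.sum_mul, h0, zero_mul, zero_add]
      simp_rw [Dθ_algHom hφ S hS hSθ, ← hM, Finset.mul_sum]
      rw [Finset.sum_comm]
      have h1 (l : Fin n) : ∑ j, ((d * C j k : evAlg n) : GE n) * (M l j * S (Dθ n l w)) =
          (d * (M * C) l k : evAlg n) * S (Dθ n l w) := by
        rw [Matrix.mul_apply, Finset.mul_sum, AddSubmonoidClass.coe_finsetSum, Finset.sum_mul]
        refine Finset.sum_congr rfl fun j _ => ?_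
        rw [← mul_assoc]
        congr 1
        exact congrArg Subtype.val (show d * C j k * M l j = d * (M l j * C j k) by ring)
      simp_rw [h1, hMC]
      rw [Finset.sum_eq_single k]
      · simp
      · intro l _ hl
        simp [Matrix.one_apply_ne hl]
      · simp
    rw [hsum, berezin_sum]
    exact Finset.sum_eq_zero fun j _ => berezin_Dθ j _
  obtain ⟨w, -, hw⟩ := exists_eq_θprod_mul_iterDθ_add (List.nodup_finRange n) v
  obtain ⟨X, hX, hX0⟩ := exists_matrix_of_evalθ0_eq_zero hφ hφ0
  have hSΘ : S (θprod (List.finRange n)) = X.det • θprod (List.finRange n) := by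
    rw [← list_prod_sum_smul_θg, θprod, ← List.ofFn_eq_map, map_list_prod, List.map_ofFn]
    congr 2
    ext j
    rw [Function.comp_apply, hSθ, hX]
  have hdet : evEval0 (d * X.det) = 1 := by
    have hXM : X.map evEval0 = M.map evEval0 := by
      ext j k
      exact (hX0 j k).trans (by rw [← hM]; rfl)
    rw [map_mul, AlgHom.map_det, AlgHom.mapMatrix_apply, hXM, ← AlgHom.mapMatrix_apply,
      ← AlgHom.map_det, ← map_mul, mul_comm, hd, map_one]
  have hc : berezin n v = evalθ0 n (iterDθ (List.finRange n) v) := berezin_eq v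
  have htop : (d : GE n) * S (θprod (List.finRange n) * berezin n v) =
      θprod (List.finRange n) * ((d * X.det : evAlg n) * berezin n v) := by
    rw [map_mul, hSΘ, hc, algHom_evalθ0 S hS, Subalgebra.smul_def, smul_eq_mul, ← mul_assoc,
      ← mul_assoc, ← mul_assoc]
    congr 1
    exact commute_of_gradeInv_eq (d * X.det).2 _
  rw [← θprod_mul_evalθ0, ← hc] at hw
  conv_rhs => rw [hw]
  rw [map_add, map_sum, mul_add, Finset.mul_sum, berezin_add, berezin_sum,
    Finset.sum_eq_zero fun k _ => hD k _, add_zero, htop, berezin_θprod_mul, map_mul]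
  have : evalθ0 n (d * X.det : evAlg n) = 1 := congrArg Subtype.val hdet
  rw [this, one_mul, hc, evalθ0_evalθ0]

end Helpers

/-- **Odd (nonlinear) change of variables in the Berezin integral.**
Let `φ₁,…,φₙ ∈ 𝒫_n` be odd with vanishing `𝔠`-component (no `θ`-free summand, i.e.
`φ_j|_{θ=0} = 0`), and suppose the matrix `((∂_{θ_k}φ_j)|_{θ=0})` (entries in `𝔠_ev`) is
invertible over `𝔠_ev`.  Then the matrix `(∂_{θ_k}φ_j)` is invertible over the even part of
`𝒫_n`, and for every `v`, `∫dθ v(θ) = ∫dθ (det(∂_{θ_k}φ_j))⁻¹·v(φ)`, where the substitution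
`θ_j ↦ φ_j` is realized by any algebra endomorphism `S` fixing the generators of `𝔠`, and
`d` is any two-sided inverse of `det(∂_{θ_k}φ_j)`. -/
theorem berezin_odd_change_of_variables
    (φ : Fin n → GE n)
    (hφodd : ∀ j, φ j ∈ oddPart n)
    (hφ0 : ∀ j, evalθ0 n (φ j) = 0)
    (hbody : ∃ B : Matrix (Fin n) (Fin n) (GE n),
      (∀ j k, B j k ∈ cAlg n ∧ B j k ∈ evenPart n) ∧
      (Matrix.of fun j k => evalθ0 n (Dθ n k (φ j))) * B = 1 ∧
      B * (Matrix.of fun j k => evalθ0 n (Dθ n k (φ j))) = 1) :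
    (∃ C : Matrix (Fin n) (Fin n) (GE n),
      (∀ j k, C j k ∈ evenPart n) ∧
      (Matrix.of fun j k => Dθ n k (φ j)) * C = 1 ∧
      C * (Matrix.of fun j k => Dθ n k (φ j)) = 1)
    ∧ ∀ d : GE n,
        detE n (Matrix.of fun j k => Dθ n k (φ j)) * d = 1 →
        d * detE n (Matrix.of fun j k => Dθ n k (φ j)) = 1 →
        ∀ S : GE n →ₐ[ℂ] GE n,
          (∀ x : ℕ →₀ ℂ, S (ExteriorAlgebra.ι ℂ (x, (0 : Fin n → ℂ)))
            = ExteriorAlgebra.ι ℂ (x, (0 : Fin n → ℂ))) →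
          (∀ j, S (θg n j) = φ j) →
          ∀ v : GE n, berezin n v = berezin n (d * S v) := by
  obtain ⟨B, hB, hbB, -⟩ := hbody
  have hφ (j : Fin n) : gradeInv (φ j) = -φ j := gradeInv_of_mem_oddPart (hφodd j)
  have hDφ (j k : Fin n) : Dθ n k (φ j) ∈ evAlg n := by
    rw [mem_evAlg, gradeInv_Dθ, hφ, map_neg, neg_neg]
  let M : Matrix (Fin n) (Fin n) (evAlg n) := Matrix.of fun j k => ⟨Dθ n k (φ j), hDφ j k⟩
  let B' : Matrix (Fin n) (Fin n) (evAlg n) :=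
    Matrix.of fun j k => ⟨B j k, mem_evenPart_iff.1 (hB j k).2⟩
  have hMB : M.map evEval0 * B' = 1 := by
    ext j k
    have := congrFun (congrFun hbB j) k
    rw [Matrix.mul_apply, AddSubmonoidClass.coe_finsetSum]
    rw [Matrix.mul_apply] at this
    refine this.trans ?_
    rw [Matrix.one_apply, Matrix.one_apply]
    split_ifs <;> rfl
  have hdet : IsUnit M.det := by
    refine isUnit_of_isUnit_evEval0 ?_
    rw [AlgHom.map_det]
    exact (Matrix.isUnit_iff_isUnit_det _).1 (IsUnit.of_mul_eq_one _ hMB)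
  have hMC : M * M⁻¹ = 1 := Matrix.mul_nonsing_inv _ hdet
  have hCM : M⁻¹ * M = 1 := Matrix.nonsing_inv_mul _ hdet
  have hMcoe : (Matrix.of fun j k => Dθ n k (φ j)) = M.map (evAlg n).val := rfl
  refine ⟨⟨M⁻¹.map (evAlg n).val, fun j k => mem_evenPart_iff.2 (M⁻¹ j k).2, ?_, ?_⟩, ?_⟩
  · rw [hMcoe, ← Matrix.map_mul, hMC]
    exact Matrix.map_one _ (map_zero _) (map_one _)
  · rw [hMcoe, ← Matrix.map_mul, hCM]
    exact Matrix.map_one _ (map_zero _) (map_one _)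
  intro d hd hd' S hS hSθ v
  have hdM : detE n (Matrix.of fun j k => Dθ n k (φ j)) = (M.det : GE n) := coe_detE_matrix M
  rw [hdM] at hd hd'
  obtain ⟨d, rfl⟩ : ∃ d' : evAlg n, (d' : GE n) = d := by
    refine ⟨Ring.inverse M.det, ?_⟩
    have : ((Ring.inverse M.det * M.det : evAlg n) : GE n) = 1 := by
      rw [Ring.inverse_mul_cancel _ hdet]
      rfl
    exact left_inv_eq_right_inv this hd
  have hdd : M.det * d = 1 := Subtype.ext hd
  exact berezin_eq_berezin_mul_algHom hφ hφ0 (fun _ _ => rfl) hMC hdd S hS hSθ v
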